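/- Let X, U : ℝ³ → ℝ be smooth in (t,x,v), and F² : ℝ³ → ℝ smooth with X = F²_v and X_x·U_v - X_v·U_x = 1 everywhere. Then locally there exist smooth functions Φ(t,x,v) and Ψ(t,x,v) such that Φ_x + U·X_x = v, Φ_v + U·X_v = 0, Ψ_x + X·U·X_x = F², and Ψ_v + X·U·X_v = 0. -/

import Mathlib

open scoped ContDiff Topology

section ParametricIntegral

variable {H E : Type} [NormedAddCommGroup H] [NormedSpace ℝ H]
  [NormedAddCommGroup E] [NormedSpace ℝ E]

theorem ContDiff.fderiv_comp_inl {f : H × ℝ → E} (hf : ContDiff ℝ ∞ f) :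
    ContDiff ℝ ∞ fun q : H × ℝ => (fderiv ℝ f q).comp (ContinuousLinearMap.inl ℝ H ℝ) :=
  (hf.fderiv_right (m := ∞) le_rfl).clm_comp contDiff_const

variable [ProperSpace H]

theorem hasFDerivAt_intervalIntegral_of_contDiff {f : H × ℝ → E} (hf : ContDiff ℝ 1 f) (a b : ℝ)
    (p : H) :
    HasFDerivAt (fun p => ∫ s in a..b, f (p, s))
      (∫ s in a..b, (fderiv ℝ f (p, s)).comp (ContinuousLinearMap.inl ℝ H ℝ)) p := by
  have hd : Continuous fun q : H × ℝ =>
      (fderiv ℝ f q).comp (ContinuousLinearMap.inl ℝ H ℝ) :=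
    (hf.continuous_fderiv one_ne_zero).clm_comp continuous_const
  obtain ⟨C, hC⟩ := ((isCompact_closedBall p 1).prod
    (isCompact_uIcc (a := a) (b := b))).exists_bound_of_continuousOn hd.continuousOn
  refine intervalIntegral.hasFDerivAt_integral_of_dominated_of_fderiv_le
    (F := fun p s => f (p, s))
    (F' := fun p s => (fderiv ℝ f (p, s)).comp (ContinuousLinearMap.inl ℝ H ℝ))
    (bound := fun _ => C) (Metric.closedBall_mem_nhds p one_pos)
    (.of_forall fun q => ?_) ?_ ?_ (.of_forall fun s hs q hq => ?_) intervalIntegrable_const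
    (.of_forall fun s _ q _ => ?_)
  · exact (hf.continuous.comp (by fun_prop : Continuous fun s : ℝ => (q, s))).aestronglyMeasurable
  · exact (hf.continuous.comp (by fun_prop : Continuous fun s : ℝ => (p, s))).intervalIntegrable a b
  · exact (hd.comp (by fun_prop : Continuous fun s : ℝ => (p, s))).aestronglyMeasurable
  · exact hC (q, s) ⟨hq, Set.uIoc_subset_uIcc hs⟩
  · exact ((hf.differentiable one_ne_zero (q, s)).hasFDerivAt).comp q
      (hasFDerivAt_prodMk_left q s)

end ParametricIntegral

theorem contDiff_intervalIntegral {H E : Type} [NormedAddCommGroup H] [NormedSpace ℝ H]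
    [ProperSpace H] [NormedAddCommGroup E] [NormedSpace ℝ E] {f : H × ℝ → E}
    (hf : ContDiff ℝ ∞ f) (a b : ℝ) :
    ContDiff ℝ ∞ fun p => ∫ s in a..b, f (p, s) := by
  refine contDiff_infty.2 fun n => ?_
  induction n generalizing E with
  | zero =>
    refine contDiff_zero.2 (continuous_iff_continuousAt.2 fun p => ?_)
    exact (hasFDerivAt_intervalIntegral_of_contDiff (hf.of_le (by simp)) a b p).continuousAt
  | succ n ih =>
    have h := hasFDerivAt_intervalIntegral_of_contDiff (hf.of_le (by simp)) a b
    push_cast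
    refine contDiff_succ_iff_fderiv.2 ⟨fun p => (h p).differentiableAt, by simp, ?_⟩
    rw [funext fun p => (h p).fderiv]
    exact ih hf.fderiv_comp_inl

theorem contDiff_primitive {H : Type} [NormedAddCommGroup H] [NormedSpace ℝ H]
    [ProperSpace H] {g : H × ℝ → ℝ} (hg : ContDiff ℝ ∞ g) :
    ContDiff ℝ ∞ fun q : H × ℝ => ∫ y in (0 : ℝ)..q.2, g (q.1, y) := by
  have h : (fun q : H × ℝ => ∫ y in (0 : ℝ)..q.2, g (q.1, y)) =
      fun q => ∫ s in (0 : ℝ)..1, q.2 * g (q.1, q.2 * s) := by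
    ext q
    simpa using (intervalIntegral.mul_integral_comp_mul_left (a := 0) (b := 1)
      (f := fun y => g (q.1, y)) (c := q.2)).symm
  rw [h]
  exact contDiff_intervalIntegral
    (f := fun r : (H × ℝ) × ℝ => r.1.2 * g (r.1.1, r.1.2 * r.2)) (by fun_prop) 0 1

section Partials

variable {G : ℝ → ℝ → ℝ → ℝ}

theorem hasDerivAt_snd_arg (hG : ContDiff ℝ ∞ fun q : ℝ × ℝ × ℝ => G q.1 q.2.1 q.2.2)
    (t x v : ℝ) :
    HasDerivAt (fun y => G t y v)
      (fderiv ℝ (fun q : ℝ × ℝ × ℝ => G q.1 q.2.1 q.2.2) (t, x, v) (0, 1, 0)) x :=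
  HasFDerivAt.comp_hasDerivAt (f := fun y : ℝ => (t, y, v)) x
    ((hG.differentiable (by simp)) (t, x, v)).hasFDerivAt
    ((hasDerivAt_const x t).prodMk ((hasDerivAt_id x).prodMk (hasDerivAt_const x v)))

theorem hasDerivAt_third_arg (hG : ContDiff ℝ ∞ fun q : ℝ × ℝ × ℝ => G q.1 q.2.1 q.2.2)
    (t x v : ℝ) :
    HasDerivAt (G t x)
      (fderiv ℝ (fun q : ℝ × ℝ × ℝ => G q.1 q.2.1 q.2.2) (t, x, v) (0, 0, 1)) v :=
  HasFDerivAt.comp_hasDerivAt (f := fun w : ℝ => (t, x, w)) v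
    ((hG.differentiable (by simp)) (t, x, v)).hasFDerivAt
    ((hasDerivAt_const v t).prodMk ((hasDerivAt_const v x).prodMk (hasDerivAt_id v)))

theorem contDiff_deriv_snd_arg (hG : ContDiff ℝ ∞ fun q : ℝ × ℝ × ℝ => G q.1 q.2.1 q.2.2) :
    ContDiff ℝ ∞ fun q : ℝ × ℝ × ℝ => deriv (fun y => G q.1 y q.2.2) q.2.1 := by
  rw [funext fun q : ℝ × ℝ × ℝ => (hasDerivAt_snd_arg hG q.1 q.2.1 q.2.2).deriv]
  exact (hG.fderiv_right (m := ∞) le_rfl).clm_apply contDiff_const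

theorem contDiff_deriv_third_arg (hG : ContDiff ℝ ∞ fun q : ℝ × ℝ × ℝ => G q.1 q.2.1 q.2.2) :
    ContDiff ℝ ∞ fun q : ℝ × ℝ × ℝ => deriv (G q.1 q.2.1) q.2.2 := by
  rw [funext fun q : ℝ × ℝ × ℝ => (hasDerivAt_third_arg hG q.1 q.2.1 q.2.2).deriv]
  exact (hG.fderiv_right (m := ∞) le_rfl).clm_apply contDiff_const

theorem deriv_deriv_comm (hG : ContDiff ℝ ∞ fun q : ℝ × ℝ × ℝ => G q.1 q.2.1 q.2.2)
    (t x v : ℝ) :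
    deriv (fun w => deriv (fun y => G t y w) x) v = deriv (fun y => deriv (G t y) v) x := by
  have hd : Differentiable ℝ (fderiv ℝ fun q : ℝ × ℝ × ℝ => G q.1 q.2.1 q.2.2) :=
    (hG.fderiv_right (m := ∞) le_rfl).differentiable (by simp)
  simp_rw [fun w => (hasDerivAt_snd_arg hG t x w).deriv,
    fun y => (hasDerivAt_third_arg hG t y v).deriv]
  have h₁ := HasFDerivAt.comp_hasDerivAt (f := fun w : ℝ => (t, x, w)) v (hd (t, x, v)).hasFDerivAt
    ((hasDerivAt_const v t).prodMk ((hasDerivAt_const v x).prodMk (hasDerivAt_id v)))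
  have h₂ := HasFDerivAt.comp_hasDerivAt (f := fun y : ℝ => (t, y, v)) x (hd (t, x, v)).hasFDerivAt
    ((hasDerivAt_const x t).prodMk ((hasDerivAt_id x).prodMk (hasDerivAt_const x v)))
  have h₁' := (h₁.clm_apply (hasDerivAt_const v ((0, 1, 0) : ℝ × ℝ × ℝ))).deriv
  have h₂' := (h₂.clm_apply (hasDerivAt_const x ((0, 0, 1) : ℝ × ℝ × ℝ))).deriv
  simp only [Function.comp_apply, map_zero, add_zero] at h₁' h₂'
  rw [h₁', h₂']
  exact (hG.contDiffAt.isSymmSndFDerivAt (by simpa using WithTop.coe_le_coe.2 (le_top (a := (2 : ℕ∞))))).eq _ _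

end Partials

/-- A smooth family of closed 1-forms `A dx + B dv` on the plane has a smooth family of
potentials. -/
theorem exists_potential {A B : ℝ → ℝ → ℝ → ℝ}
    (hA : ContDiff ℝ ∞ fun q : ℝ × ℝ × ℝ => A q.1 q.2.1 q.2.2)
    (hB : ContDiff ℝ ∞ fun q : ℝ × ℝ × ℝ => B q.1 q.2.1 q.2.2)
    (hAB : ∀ t x v, deriv (A t x) v = deriv (fun y => B t y v) x) :
    ∃ Φ : ℝ → ℝ → ℝ → ℝ, ContDiff ℝ ∞ (fun q : ℝ × ℝ × ℝ => Φ q.1 q.2.1 q.2.2) ∧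
      ∀ t x v, HasDerivAt (fun y => Φ t y v) (A t x v) x ∧ HasDerivAt (Φ t x) (B t x v) v := by
  have cA {t v : ℝ} : Continuous fun y => A t y v :=
    hA.continuous.comp (by fun_prop : Continuous fun y : ℝ => (t, y, v))
  have cB {t x : ℝ} : Continuous fun w => B t x w :=
    hB.continuous.comp (by fun_prop : Continuous fun w : ℝ => (t, x, w))
  refine ⟨fun t x v => (∫ y in (0 : ℝ)..x, A t y v) + ∫ w in (0 : ℝ)..v, B t 0 w, ?_,
    fun t x v => ⟨?_, ?_⟩⟩
  · have h₁ := contDiff_primitive (g := fun r : (ℝ × ℝ) × ℝ => A r.1.1 r.2 r.1.2)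
      (hA.comp (by fun_prop : ContDiff ℝ ∞ fun r : (ℝ × ℝ) × ℝ => (r.1.1, r.2, r.1.2)))
    have h₂ := contDiff_primitive (g := fun r : ℝ × ℝ => B r.1 0 r.2)
      (hB.comp (by fun_prop : ContDiff ℝ ∞ fun r : ℝ × ℝ => (r.1, (0 : ℝ), r.2)))
    exact (h₁.comp
        (by fun_prop : ContDiff ℝ ∞ fun q : ℝ × ℝ × ℝ => ((q.1, q.2.2), q.2.1))).add
      (h₂.comp (by fun_prop : ContDiff ℝ ∞ fun q : ℝ × ℝ × ℝ => (q.1, q.2.2)))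
  · exact (cA.integral_hasStrictDerivAt 0 x).hasDerivAt.add_const _
  · have hf : ContDiff ℝ ∞ fun r : ℝ × ℝ => A t r.2 r.1 :=
      hA.comp (by fun_prop : ContDiff ℝ ∞ fun r : ℝ × ℝ => (t, r.2, r.1))
    have hd := (hasFDerivAt_intervalIntegral_of_contDiff (hf.of_le (by simp)) 0 x v).hasDerivAt
    have hc : Continuous fun y => (fderiv ℝ (fun r : ℝ × ℝ => A t r.2 r.1) (v, y)).comp
        (ContinuousLinearMap.inl ℝ ℝ ℝ) :=
      hf.fderiv_comp_inl.continuous.comp (by fun_prop : Continuous fun y : ℝ => (v, y))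
    rw [ContinuousLinearMap.intervalIntegral_apply (hc.intervalIntegrable 0 x)] at hd
    have hpt (y : ℝ) : (fderiv ℝ (fun r : ℝ × ℝ => A t r.2 r.1) (v, y)).comp
        (ContinuousLinearMap.inl ℝ ℝ ℝ) 1 = deriv (fun z => B t z v) y := by
      rw [← hAB]
      exact (HasFDerivAt.comp_hasDerivAt (f := fun w : ℝ => (w, y)) v
        ((hf.differentiable (by simp)) (v, y)).hasFDerivAt
        ((hasDerivAt_id v).prodMk (hasDerivAt_const v y))).deriv.symm
    have hFTC : ∫ y in (0 : ℝ)..x, deriv (fun z => B t z v) y = B t x v - B t 0 v := by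
      refine intervalIntegral.integral_deriv_eq_sub' (fun z => B t z v) rfl
        (fun y _ => (hasDerivAt_snd_arg hB t y v).differentiableAt) ?_
      exact ((contDiff_deriv_snd_arg hB).continuous.comp
        (by fun_prop : Continuous fun y : ℝ => (t, y, v))).continuousOn
    simp_rw [hpt] at hd
    rw [hFTC] at hd
    exact (hd.add ((cB (t := t) (x := 0)).integral_hasStrictDerivAt 0 v).hasDerivAt).congr_deriv
      (sub_add_cancel _ _)


/-- Compatibility argument in the proof of Lemma 6: with X = F²_v and unit
Jacobian X_x U_v - X_v U_x = 1, the overdetermined systems for Φ and Ψ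
admit local solutions. -/
theorem local_potentials_exist
    (X U F2 : ℝ → ℝ → ℝ → ℝ)
    (hX : ContDiff ℝ (⊤ : ℕ∞) (fun q : ℝ × ℝ × ℝ => X q.1 q.2.1 q.2.2))
    (hU : ContDiff ℝ (⊤ : ℕ∞) (fun q : ℝ × ℝ × ℝ => U q.1 q.2.1 q.2.2))
    (hF2 : ContDiff ℝ (⊤ : ℕ∞) (fun q : ℝ × ℝ × ℝ => F2 q.1 q.2.1 q.2.2))
    (hXF2 : ∀ t x v : ℝ, X t x v = deriv (F2 t x) v)
    (hJac : ∀ t x v : ℝ,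
      deriv (fun y => X t y v) x * deriv (U t x) v
        - deriv (X t x) v * deriv (fun y => U t y v) x = 1) :
    ∀ t₀ x₀ v₀ : ℝ, ∃ s : Set (ℝ × ℝ × ℝ), IsOpen s ∧ (t₀, x₀, v₀) ∈ s ∧
      ∃ Φ Ψ : ℝ → ℝ → ℝ → ℝ,
        ContDiff ℝ (⊤ : ℕ∞) (fun q : ℝ × ℝ × ℝ => Φ q.1 q.2.1 q.2.2) ∧
        ContDiff ℝ (⊤ : ℕ∞) (fun q : ℝ × ℝ × ℝ => Ψ q.1 q.2.1 q.2.2) ∧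
        ∀ t x v : ℝ, (t, x, v) ∈ s →
          deriv (fun y => Φ t y v) x + U t x v * deriv (fun y => X t y v) x = v ∧
          deriv (Φ t x) v + U t x v * deriv (X t x) v = 0 ∧
          deriv (fun y => Ψ t y v) x
            + X t x v * U t x v * deriv (fun y => X t y v) x = F2 t x v ∧
          deriv (Ψ t x) v + X t x v * U t x v * deriv (X t x) v = 0 := by
  intro t₀ x₀ v₀
  have hXx := contDiff_deriv_snd_arg hX
  have hXv := contDiff_deriv_third_arg hX
  have dx {G : ℝ → ℝ → ℝ → ℝ} (hG : ContDiff ℝ ∞ fun q : ℝ × ℝ × ℝ => G q.1 q.2.1 q.2.2)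
      (t x v : ℝ) : HasDerivAt (fun y => G t y v) (deriv (fun y => G t y v) x) x :=
    (hasDerivAt_snd_arg hG t x v).differentiableAt.hasDerivAt
  have dv {G : ℝ → ℝ → ℝ → ℝ} (hG : ContDiff ℝ ∞ fun q : ℝ × ℝ × ℝ => G q.1 q.2.1 q.2.2)
      (t x v : ℝ) : HasDerivAt (fun w => G t x w) (deriv (G t x) v) v :=
    (hasDerivAt_third_arg hG t x v).differentiableAt.hasDerivAt
  have dXxv (t x v : ℝ) := dv (G := fun t x v => deriv (fun y => X t y v) x) hXx t x v
  have dXvx (t x v : ℝ) := dx (G := fun t x v => deriv (X t x) v) hXv t x v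
  obtain ⟨Φ, hΦ, hΦ'⟩ := exists_potential
    (A := fun t x v => v - U t x v * deriv (fun y => X t y v) x)
    (B := fun t x v => -(U t x v * deriv (X t x) v))
    (contDiff_snd.snd.sub (hU.mul hXx)) (hU.mul hXv).neg fun t x v => by
      have h₁ := ((hasDerivAt_id v).sub ((dv hU t x v).mul (dXxv t x v))).deriv
      have h₂ := ((dx hU t x v).mul (dXvx t x v)).neg.deriv
      refine h₁.trans (Eq.trans ?_ h₂.symm)
      rw [deriv_deriv_comm hX]
      linear_combination -hJac t x v
  obtain ⟨Ψ, hΨ, hΨ'⟩ := exists_potential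
    (A := fun t x v => F2 t x v - X t x v * U t x v * deriv (fun y => X t y v) x)
    (B := fun t x v => -(X t x v * U t x v * deriv (X t x) v))
    (hF2.sub ((hX.mul hU).mul hXx)) ((hX.mul hU).mul hXv).neg fun t x v => by
      have h₁ := ((dv hF2 t x v).sub
        (((dv hX t x v).mul (dv hU t x v)).mul (dXxv t x v))).deriv
      have h₂ := (((dx hX t x v).mul (dx hU t x v)).mul (dXvx t x v)).neg.deriv
      refine h₁.trans (Eq.trans ?_ h₂.symm)
      rw [deriv_deriv_comm hX, ← hXF2]
      simp only [Pi.mul_apply]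
      linear_combination -X t x v * hJac t x v
  refine ⟨Set.univ, isOpen_univ, Set.mem_univ _, Φ, Ψ, hΦ, hΨ, fun t x v _ => ?_⟩
  rw [(hΦ' t x v).1.deriv, (hΦ' t x v).2.deriv, (hΨ' t x v).1.deriv, (hΨ' t x v).2.deriv]
  refine ⟨?_, ?_, ?_, ?_⟩ <;> ring
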